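/- The infinite series identity $\sum_{k=0}^{\infty}\frac{2+3k}{(-8)^k}\frac{((1)_k)^3}{((3/2)_k)^3}\Big\{H_{1+2k}^{(2)}-\frac{5}{4}H_{k}^{(2)}\Big\} = 2\beta(4)$ holds. -/

import Mathlib

open scoped BigOperators

/-- The shifted factorial (Pochhammer symbol) `(x)_n = x (x+1) ⋯ (x+n-1)`. -/
noncomputable def poch (x : ℝ) (n : ℕ) : ℝ := ∏ i ∈ Finset.range n, (x + i)

/-- The harmonic numbers of order 2, `H_n^{(2)} = ∑_{j=1}^n 1/j²`. -/
noncomputable def H2 (n : ℕ) : ℝ := ∑ j ∈ Finset.range n, 1 / ((j : ℝ) + 1) ^ 2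

/-- The Dirichlet beta value `β(4) = ∑_{k≥0} (-1)^k/(1+2k)⁴`. -/
noncomputable def beta4 : ℝ := ∑' k : ℕ, (-1) ^ k / (1 + 2 * (k : ℝ)) ^ 4

/-- The Catalan constant `G = ∑_{k≥0} (-1)^k/(1+2k)²`. -/
noncomputable def catalanG : ℝ := ∑' k : ℕ, (-1) ^ k / (1 + 2 * (k : ℝ)) ^ 2

open Filter Topology

theorem poch_succ (x : ℝ) (n : ℕ) : poch x (n + 1) = poch x n * (x + n) := by
  simp [poch, Finset.prod_range_succ]

theorem poch_pos {x : ℝ} (hx : 0 < x) (n : ℕ) : 0 < poch x n :=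
  Finset.prod_pos fun _ _ => by positivity

theorem mul_poch_add_one (x : ℝ) (n : ℕ) : x * poch (x + 1) n = poch x n * (x + n) := by
  rw [← poch_succ, poch, poch, Finset.prod_range_succ', mul_comm]
  congr 1
  · exact Finset.prod_congr rfl fun i _ => by push_cast; ring
  · simp

theorem poch_one (n : ℕ) : poch 1 n = n.factorial := by
  induction n with
  | zero => simp [poch]
  | succ n ih => rw [poch_succ, ih, Nat.factorial_succ]; push_cast; ring

theorem factorial_two_mul_eq (n : ℕ) :
    ((2 * n).factorial : ℝ) = 4 ^ n * n.factorial * poch (1 / 2) n := by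
  induction n with
  | zero => simp [poch]
  | succ n ih =>
    rw [poch_succ, Nat.factorial_succ, show 2 * (n + 1) = 2 * n + 1 + 1 by ring,
      Nat.factorial_succ, Nat.factorial_succ]
    push_cast
    rw [ih]
    ring

/-- The partial sums `∑_{j<n} 1/(x+j)²` of the Hurwitz zeta value `ζ(2, x)`. -/
noncomputable def hurwitzSum (x : ℝ) (n : ℕ) : ℝ := ∑ j ∈ Finset.range n, 1 / (x + j) ^ 2

theorem hurwitzSum_succ (x : ℝ) (n : ℕ) :
    hurwitzSum x (n + 1) = hurwitzSum x n + 1 / (x + n) ^ 2 := by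
  simp [hurwitzSum, Finset.sum_range_succ]

theorem hurwitzSum_nonneg (x : ℝ) (n : ℕ) : 0 ≤ hurwitzSum x n :=
  Finset.sum_nonneg fun _ _ => by positivity

theorem hurwitzSum_add_one (x : ℝ) (n : ℕ) :
    hurwitzSum (x + 1) n + 1 / x ^ 2 = hurwitzSum x n + 1 / (x + n) ^ 2 := by
  rw [← hurwitzSum_succ, hurwitzSum, hurwitzSum, Finset.sum_range_succ']
  congr 1
  · exact Finset.sum_congr rfl fun i _ => by push_cast; ring
  · simp

theorem H2_succ (n : ℕ) : H2 (n + 1) = H2 n + 1 / ((n : ℝ) + 1) ^ 2 := by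
  simp [H2, Finset.sum_range_succ]

theorem H2_nonneg (n : ℕ) : 0 ≤ H2 n :=
  Finset.sum_nonneg fun _ _ => by positivity

theorem H2_le (n : ℕ) : H2 n ≤ 2 := by
  have h : ∀ n : ℕ, H2 (n + 1) ≤ 2 - 1 / ((n : ℝ) + 1) := by
    intro n
    induction n with
    | zero => norm_num [H2]
    | succ n ih =>
      rw [H2_succ]
      have h : 2 - 1 / (((n + 1 : ℕ) : ℝ) + 1)
          - (2 - 1 / ((n : ℝ) + 1) + 1 / (((n + 1 : ℕ) : ℝ) + 1) ^ 2)
          = 1 / (((n : ℝ) + 1) * (n + 2) ^ 2) := by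
        push_cast
        field_simp
        ring
      have : 0 < 1 / (((n : ℝ) + 1) * (n + 2) ^ 2) := by positivity
      linarith
  have h1 := h n
  rw [H2_succ] at h1
  have h2 : 0 ≤ 1 / ((n : ℝ) + 1) := by positivity
  have h3 : 0 ≤ 1 / ((n : ℝ) + 1) ^ 2 := by positivity
  linarith

theorem hurwitzSum_le {x : ℝ} (hx : 1 / 2 ≤ x) (n : ℕ) : hurwitzSum x n ≤ 8 := by
  have h : hurwitzSum x n ≤ 4 * H2 n := by
    rw [hurwitzSum, H2, Finset.mul_sum]
    refine Finset.sum_le_sum fun j _ => ?_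
    rw [mul_one_div, div_le_div_iff₀ (by positivity) (by positivity)]
    have : (j : ℝ) + 1 ≤ 2 * (x + j) := by
      have : (0 : ℝ) ≤ j := by positivity
      linarith
    nlinarith [this, (by positivity : (0 : ℝ) ≤ j)]
  linarith [H2_le n]

/-- The summand `n! (x)_n / ((x)_{n+1})²`. -/
noncomputable def gaussTerm (x : ℝ) (n : ℕ) : ℝ := n.factorial / (poch x n * (x + n) ^ 2)

theorem gaussTerm_pos {x : ℝ} (hx : 0 < x) (n : ℕ) : 0 < gaussTerm x n := by
  have := poch_pos hx n
  unfold gaussTerm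
  positivity

theorem gaussTerm_le {x : ℝ} (hx : 1 / 2 ≤ x) (n : ℕ) : gaussTerm x n ≤ gaussTerm (1 / 2) n := by
  unfold gaussTerm
  have h1 := poch_pos (x := 1 / 2) (by norm_num) n
  have h2 : poch (1 / 2) n ≤ poch x n :=
    Finset.prod_le_prod (fun _ _ => by positivity) fun _ _ => by linarith
  have h3 := h1.trans_le h2
  gcongr

theorem gaussTerm_succ {x : ℝ} (hx : 0 < x) (n : ℕ) :
    gaussTerm x (n + 1) = gaussTerm x n * ((n + 1) * (x + n) / (x + n + 1) ^ 2) := by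
  have := poch_pos hx n
  rw [gaussTerm, gaussTerm, poch_succ, Nat.factorial_succ]
  push_cast
  field_simp
  ring

theorem gaussTerm_add_one {x : ℝ} (hx : 0 < x) (n : ℕ) :
    gaussTerm (x + 1) n = gaussTerm x n * (x * (x + n) / (x + n + 1) ^ 2) := by
  have h1 := poch_pos hx n
  have h2 : poch (x + 1) n = poch x n * (x + n) / x := by
    rw [← mul_poch_add_one]; field_simp
  rw [gaussTerm, gaussTerm, h2]
  field_simp
  ring

theorem tendsto_gaussTerm_half :
    Tendsto (fun n : ℕ => ((n : ℝ) + 1) * gaussTerm (1 / 2) n) atTop (𝓝 0) := by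
  have hw : ∀ n : ℕ, (n.factorial / poch (1 / 2) n : ℝ) ^ 2 ≤ 4 * n + 1 := by
    intro n
    induction n with
    | zero => simp [poch]
    | succ n ih =>
      have hp := poch_pos (x := 1 / 2) (by norm_num) n
      have : ((n + 1).factorial / poch (1 / 2) (n + 1) : ℝ) ^ 2
          = (n.factorial / poch (1 / 2) n : ℝ) ^ 2 * ((n + 1) / (1 / 2 + n)) ^ 2 := by
        rw [poch_succ, Nat.factorial_succ]
        push_cast
        field_simp
      rw [this]
      refine (mul_le_mul_of_nonneg_right ih (by positivity)).trans ?_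
      rw [div_pow, mul_div_assoc', div_le_iff₀ (by positivity)]
      push_cast
      nlinarith
  have hsq : Tendsto (fun n : ℕ => (((n : ℝ) + 1) * gaussTerm (1 / 2) n) ^ 2) atTop (𝓝 0) := by
    have hlim : Tendsto (fun n : ℕ => 64 * (1 / ((n : ℝ) + 1))) atTop (𝓝 0) := by
      simpa using tendsto_one_div_add_atTop_nhds_zero_nat.const_mul (64 : ℝ)
    refine squeeze_zero (fun n => by positivity) (fun n => ?_) hlim
    have : (((n : ℝ) + 1) * gaussTerm (1 / 2) n) ^ 2
        = (n.factorial / poch (1 / 2) n : ℝ) ^ 2 * ((n + 1) ^ 2 / (1 / 2 + n) ^ 4) := by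
      have hp := poch_pos (x := 1 / 2) (by norm_num) n
      rw [gaussTerm]
      field_simp
    rw [this]
    refine (mul_le_mul_of_nonneg_right (hw n) (by positivity)).trans ?_
    rw [mul_one_div, mul_div_assoc', div_le_div_iff₀ (by positivity) (by positivity)]
    have hn : (0 : ℝ) ≤ n := by positivity
    have : (0 : ℝ) ≤ n ^ 2 := by positivity
    have : (0 : ℝ) ≤ n ^ 3 := by positivity
    have : (0 : ℝ) ≤ n ^ 4 := by positivity
    ring_nf
    nlinarith
  have := hsq.sqrt
  simp only [Real.sqrt_zero] at this
  refine this.congr fun n => Real.sqrt_sq ?_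
  have := gaussTerm_pos (x := 1 / 2) (by norm_num) n
  positivity

/-- The `y`-coefficient of `n! (x)_n / ∏_{j≤n} ((x+j)² - y)`. -/
noncomputable def gaussCoeff (x : ℝ) (n : ℕ) : ℝ := gaussTerm x n * hurwitzSum x (n + 1)

theorem gaussCoeff_nonneg {x : ℝ} (hx : 0 < x) (n : ℕ) : 0 ≤ gaussCoeff x n :=
  mul_nonneg (gaussTerm_pos hx n).le (hurwitzSum_nonneg _ _)

theorem gaussCoeff_le {x : ℝ} (hx : 1 / 2 ≤ x) (n : ℕ) :
    gaussCoeff x n ≤ 8 * gaussTerm (1 / 2) n := by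
  rw [gaussCoeff, mul_comm]
  exact mul_le_mul (hurwitzSum_le hx _) (gaussTerm_le hx n)
    (gaussTerm_pos (by linarith) n).le (by norm_num)

theorem gaussCoeff_add_gaussCoeff {x : ℝ} (hx : 0 < x) (n : ℕ) :
    gaussCoeff x n + gaussCoeff (x + 1) n = (2 * x + n) / x * gaussCoeff x n
      - (2 * x + (n + 1 : ℕ)) / x * gaussCoeff x (n + 1) := by
  have h := hurwitzSum_add_one x (n + 1)
  have h' : hurwitzSum (x + 1) (n + 1)
      = hurwitzSum x (n + 1) + 1 / (x + n + 1) ^ 2 - 1 / x ^ 2 := by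
    rw [eq_sub_iff_add_eq, h]; push_cast; ring
  rw [gaussCoeff, gaussCoeff, gaussCoeff, h', gaussTerm_succ hx, gaussTerm_add_one hx,
    hurwitzSum_succ x (n + 1)]
  push_cast
  field_simp
  ring

theorem hasSum_gaussCoeff_add {x : ℝ} (hx : 1 / 2 ≤ x) :
    HasSum (fun n => gaussCoeff x n + gaussCoeff (x + 1) n) (2 / x ^ 4) := by
  have hx0 : 0 < x := by linarith
  rw [hasSum_iff_tendsto_nat_of_nonneg fun n =>
    add_nonneg (gaussCoeff_nonneg hx0 n) (gaussCoeff_nonneg (by linarith) n)]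
  have hlim : Tendsto (fun n : ℕ => (2 * x + n) / x * gaussCoeff x n) atTop (𝓝 0) := by
    have h := tendsto_gaussTerm_half.const_mul (8 * (2 + 1 / x))
    rw [mul_zero] at h
    refine squeeze_zero (fun n => mul_nonneg (by positivity) (gaussCoeff_nonneg hx0 n))
      (fun n => ?_) h
    have hg := gaussTerm_pos (x := 1 / 2) (by norm_num) n
    have : (2 * x + n) / x ≤ (2 + 1 / x) * (n + 1) := by
      rw [div_le_iff₀ hx0]
      have : (2 + 1 / x) * (n + 1) * x = (2 * x + 1) * (n + 1) := by field_simp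
      rw [this]
      have : (0 : ℝ) ≤ n * x := by positivity
      nlinarith
    calc _ ≤ (2 + 1 / x) * (n + 1) * (8 * gaussTerm (1 / 2) n) :=
          mul_le_mul this (gaussCoeff_le hx n) (gaussCoeff_nonneg hx0 n) (by positivity)
      _ = _ := by ring
  have h0 : (2 * x + (0 : ℕ)) / x * gaussCoeff x 0 = 2 / x ^ 4 := by
    simp [gaussCoeff, gaussTerm, hurwitzSum, poch]
    field_simp
  have := hlim.const_sub (2 / x ^ 4)
  rw [sub_zero] at this
  refine this.congr fun N => ?_
  rw [Finset.sum_congr rfl fun n _ => gaussCoeff_add_gaussCoeff hx0 n,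
    Finset.sum_range_sub' (fun n : ℕ => (2 * x + n) / x * gaussCoeff x n), h0]

theorem summable_gaussCoeff {x : ℝ} (hx : 1 / 2 ≤ x) : Summable (gaussCoeff x) :=
  (hasSum_gaussCoeff_add hx).summable.of_nonneg_of_le (gaussCoeff_nonneg (by linarith))
    fun n => le_add_of_nonneg_right (gaussCoeff_nonneg (by linarith) n)

theorem tsum_gaussCoeff_add {x : ℝ} (hx : 1 / 2 ≤ x) :
    ∑' n, gaussCoeff x n + ∑' n, gaussCoeff (x + 1) n = 2 / x ^ 4 := by
  rw [← (summable_gaussCoeff hx).tsum_add (summable_gaussCoeff (by linarith)),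
    (hasSum_gaussCoeff_add hx).tsum_eq]

theorem summable_beta4 : Summable fun k : ℕ => (-1 : ℝ) ^ k / (1 + 2 * (k : ℝ)) ^ 4 := by
  have h : Summable fun k : ℕ => 1 / ((k + 1 : ℕ) : ℝ) ^ 4 :=
    (summable_nat_add_iff 1).2 (Real.summable_one_div_nat_pow.2 (by norm_num))
  refine h.of_norm_bounded fun k => ?_
  rw [norm_div, norm_pow, norm_neg, norm_one, one_pow, Real.norm_of_nonneg (by positivity)]
  have : (0 : ℝ) ≤ k := by positivity
  push_cast
  gcongr 1 / ?_ ^ 4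
  linarith

theorem tsum_gaussCoeff_half : ∑' n, gaussCoeff (1 / 2) n = 32 * beta4 := by
  set T : ℕ → ℝ := fun m => ∑' n, gaussCoeff (1 / 2 + m) n with hT
  have hm : ∀ m : ℕ, (1 / 2 : ℝ) ≤ 1 / 2 + m := fun m => by
    have : (0 : ℝ) ≤ m := by positivity
    linarith
  have hrec : ∀ m : ℕ, T m + T (m + 1) = 32 * (1 / (1 + 2 * (m : ℝ)) ^ 4) := by
    intro m
    have h := tsum_gaussCoeff_add (hm m)
    simp only [hT]
    push_cast
    rw [← add_assoc, h]
    field_simp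
    ring
  have hT0 : ∀ m, 0 ≤ T m := fun m => tsum_nonneg (gaussCoeff_nonneg (by positivity))
  have hlim : Tendsto (fun m => (-1 : ℝ) ^ m * T m) atTop (𝓝 0) := by
    rw [tendsto_zero_iff_norm_tendsto_zero]
    have h := (summable_beta4.norm.tendsto_atTop_zero).const_mul 32
    rw [mul_zero] at h
    refine squeeze_zero (fun _ => norm_nonneg _) (fun m => ?_) h
    rw [norm_mul, norm_div, norm_pow, norm_neg, norm_one, one_pow, one_mul,
      Real.norm_of_nonneg (hT0 m), Real.norm_of_nonneg (by positivity), ← hrec m]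
    linarith [hT0 (m + 1)]
  have hsum : ∀ K : ℕ, ∑ k ∈ Finset.range K, (-1 : ℝ) ^ k / (1 + 2 * (k : ℝ)) ^ 4
      = (T 0 - (-1) ^ K * T K) / 32 := by
    intro K
    induction K with
    | zero => simp
    | succ K ih =>
      have := hrec K
      rw [Finset.sum_range_succ, ih, div_eq_mul_one_div ((-1 : ℝ) ^ K), pow_succ]
      linear_combination -(-1) ^ K / 32 * this
  have h1 := summable_beta4.hasSum.tendsto_sum_nat
  have h2 : Tendsto (fun K : ℕ => (T 0 - (-1) ^ K * T K) / 32) atTop (𝓝 ((T 0 - 0) / 32)) :=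
    (hlim.const_sub _).div_const _
  have h3 := tendsto_nhds_unique h1 (h2.congr fun K => (hsum K).symm)
  have h4 : T 0 = ∑' n, gaussCoeff (1 / 2) n := by simp [hT]
  rw [beta4, h3, ← h4]
  ring

/-- The summand `(2n+k)! k!² / (4^n (-8)^k (3/2)_k ((1/2)_{n+k+1})²)`. -/
noncomputable def accelTerm (n k : ℕ) : ℝ :=
  (2 * n + k).factorial * k.factorial ^ 2 /
    (4 ^ n * (-8) ^ k * poch (3 / 2) k * poch (1 / 2) (n + k + 1) ^ 2)

theorem accelTerm_succ_left (n k : ℕ) :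
    accelTerm (n + 1) k
      = accelTerm n k * ((2 * n + k + 1) * (2 * n + k + 2) / (4 * (n + k + 3 / 2) ^ 2)) := by
  have h1 := poch_pos (x := 1 / 2) (by norm_num) (n + k + 1)
  have h2 := poch_pos (x := 3 / 2) (by norm_num) k
  rw [accelTerm, accelTerm, show n + 1 + k + 1 = n + k + 1 + 1 by ring,
    poch_succ (1 / 2) (n + k + 1),
    show 2 * (n + 1) + k = 2 * n + k + 1 + 1 by ring, Nat.factorial_succ, Nat.factorial_succ,
    show (1 / 2 + ((n + k + 1 : ℕ) : ℝ)) = n + k + 3 / 2 by push_cast; ring, pow_succ (4 : ℝ)]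
  push_cast
  field_simp
  ring

theorem accelTerm_succ_right (n k : ℕ) :
    accelTerm n (k + 1)
      = accelTerm n k *
        (-((2 * n + k + 1) * (k + 1) ^ 2 / (8 * (k + 3 / 2) * (n + k + 3 / 2) ^ 2))) := by
  have h1 := poch_pos (x := 1 / 2) (by norm_num) (n + k + 1)
  have h2 := poch_pos (x := 3 / 2) (by norm_num) k
  rw [accelTerm, accelTerm, ← add_assoc n k 1, poch_succ (1 / 2) (n + k + 1),
    ← add_assoc (2 * n) k 1, Nat.factorial_succ, Nat.factorial_succ, poch_succ (3 / 2) k,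
    show (1 / 2 + ((n + k + 1 : ℕ) : ℝ)) = n + k + 3 / 2 by push_cast; ring, pow_succ (-8 : ℝ)]
  push_cast
  field_simp
  ring

theorem accelTerm_zero_right (n : ℕ) : accelTerm n 0 = gaussTerm (1 / 2) n := by
  have h1 := poch_pos (x := 1 / 2) (by norm_num) n
  rw [accelTerm, gaussTerm, add_zero, add_zero, poch_succ, factorial_two_mul_eq]
  simp [poch] at h1 ⊢
  field_simp

theorem abs_accelTerm_le (n k : ℕ) :
    |accelTerm n k| ≤ gaussTerm (1 / 2) n * (1 / 8) ^ k := by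
  induction k with
  | zero =>
    rw [accelTerm_zero_right, abs_of_pos (gaussTerm_pos (by norm_num) n)]
    simp
  | succ k ih =>
    rw [accelTerm_succ_right, abs_mul, abs_neg, abs_of_nonneg (a := _ / _) (by positivity),
      pow_succ (1 / 8 : ℝ), ← mul_assoc (gaussTerm _ _)]
    refine mul_le_mul ih ?_ (by positivity) ((abs_nonneg _).trans ih)
    have hn : (0 : ℝ) ≤ n := by positivity
    have hk : (0 : ℝ) ≤ k := by positivity
    rw [div_le_div_iff₀ (by positivity) (by positivity)]
    have h : (2 * n + k + 1) * (k + 1) ≤ ((n : ℝ) + k + 3 / 2) ^ 2 := by nlinarith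
    have h' := mul_le_mul h (by linarith : (k : ℝ) + 1 ≤ k + 3 / 2) (by positivity) (by positivity)
    nlinarith

/-- The `y`-coefficient of the deformation of `accelTerm` in which `(j + 1/2)²` becomes
`(j + 1/2)² - y` and `j²` becomes `j² - 4y`. -/
noncomputable def accelCoeff (n k : ℕ) : ℝ :=
  accelTerm n k * (hurwitzSum (1 / 2) (n + k + 1) - 4 * H2 k)

theorem abs_accelCoeff_le (n k : ℕ) :
    |accelCoeff n k| ≤ 8 * (gaussTerm (1 / 2) n * (1 / 8) ^ k) := by
  rw [accelCoeff, abs_mul, mul_comm]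
  refine mul_le_mul ?_ (abs_accelTerm_le n k) (abs_nonneg _) (by norm_num)
  have h1 := hurwitzSum_nonneg (1 / 2) (n + k + 1)
  have h2 := hurwitzSum_le le_rfl (n + k + 1)
  have h3 := H2_nonneg k
  have h4 := H2_le k
  rw [abs_le]
  constructor <;> linarith

theorem accelCoeff_sub (n k : ℕ) :
    (3 * k + 2 * n + 2) * accelCoeff n k - (3 * k + 2 * (n + 1 : ℕ) + 2) * accelCoeff (n + 1) k
      = (2 * k + 1) * accelCoeff n k - (2 * (k + 1 : ℕ) + 1) * accelCoeff n (k + 1) := by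
  rw [accelCoeff, accelCoeff, accelCoeff, accelTerm_succ_left, accelTerm_succ_right,
    show n + 1 + k + 1 = n + k + 1 + 1 by ring, ← add_assoc n k 1, hurwitzSum_succ _ (n + k + 1), H2_succ,
    show (1 / 2 + ((n + k + 1 : ℕ) : ℝ)) = n + k + 3 / 2 by push_cast; ring]
  push_cast
  field_simp
  ring

theorem summable_mul_geometric : Summable fun k : ℕ => ((k : ℝ) + 1) * (1 / 8) ^ k := by
  have h1 := summable_pow_mul_geometric_of_norm_lt_one 1 (r := (1 / 8 : ℝ)) (by norm_num)
  have h2 := summable_geometric_of_lt_one (r := (1 / 8 : ℝ)) (by norm_num) (by norm_num)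
  exact (h1.add h2).congr fun k => by ring

theorem norm_mul_accelCoeff_le (n k : ℕ) :
    ‖(3 * k + 2 * n + 2) * accelCoeff n k‖
      ≤ 24 * ((n + 1) * gaussTerm (1 / 2) n) * ((k + 1) * (1 / 8) ^ k) := by
  have hk : (0 : ℝ) ≤ n * k := by positivity
  have hn : (0 : ℝ) ≤ n := by positivity
  rw [norm_mul, Real.norm_of_nonneg (by positivity)]
  calc _ ≤ (3 * ((n + 1) * (k + 1))) * (8 * (gaussTerm (1 / 2) n * (1 / 8) ^ k)) :=
        mul_le_mul (by nlinarith) (abs_accelCoeff_le n k) (abs_nonneg _) (by positivity)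
    _ = _ := by ring

theorem summable_mul_accelCoeff (n : ℕ) :
    Summable fun k : ℕ => (3 * k + 2 * n + 2) * accelCoeff n k :=
  (summable_mul_geometric.mul_left _).of_norm_bounded (norm_mul_accelCoeff_le n)

theorem summable_two_mul_add_one_mul_accelCoeff (n : ℕ) :
    Summable fun k : ℕ => (2 * k + 1) * accelCoeff n k := by
  refine (summable_mul_accelCoeff n).norm.of_norm_bounded fun k => ?_
  have hk : (0 : ℝ) ≤ k := by positivity
  have hn : (0 : ℝ) ≤ n := by positivity
  rw [norm_mul, norm_mul]
  refine mul_le_mul_of_nonneg_right ?_ (norm_nonneg _)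
  rw [Real.norm_of_nonneg (by positivity), Real.norm_of_nonneg (by positivity)]
  linarith

theorem accelCoeff_zero_right (n : ℕ) : accelCoeff n 0 = gaussCoeff (1 / 2) n := by
  simp [accelCoeff, gaussCoeff, accelTerm_zero_right, H2]

theorem tsum_accelCoeff_zero :
    ∑' k : ℕ, (3 * k + 2) * accelCoeff 0 k = ∑' n, gaussCoeff (1 / 2) n := by
  set S : ℕ → ℝ := fun n => ∑' k : ℕ, (3 * k + 2 * n + 2) * accelCoeff n k with hS
  have hrec : ∀ n, gaussCoeff (1 / 2) n = S n - S (n + 1) := by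
    intro n
    have hc := summable_two_mul_add_one_mul_accelCoeff n
    rw [hS]
    beta_reduce
    rw [← (summable_mul_accelCoeff n).tsum_sub (summable_mul_accelCoeff (n + 1)),
      tsum_congr (accelCoeff_sub n), hc.tsum_sub ((summable_nat_add_iff 1).2 hc),
      hc.tsum_eq_zero_add]
    simp [accelCoeff_zero_right]
  have hlim : Tendsto S atTop (𝓝 0) := by
    have h := (tendsto_gaussTerm_half.const_mul 24).mul_const
      (∑' k : ℕ, ((k : ℝ) + 1) * (1 / 8) ^ k)
    rw [mul_zero, zero_mul] at h
    refine squeeze_zero_norm (fun n => ?_) h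
    exact tsum_of_norm_bounded (summable_mul_geometric.hasSum.mul_left _)
      (norm_mul_accelCoeff_le n)
  have h1 := (summable_gaussCoeff le_rfl).hasSum.tendsto_sum_nat
  have h2 := hlim.const_sub (S 0)
  rw [sub_zero] at h2
  rw [tendsto_nhds_unique h1 (h2.congr fun N => by
    rw [Finset.sum_congr rfl fun n _ => hrec n, Finset.sum_range_sub'])]
  simp [hS]

theorem hurwitzSum_half (k : ℕ) :
    hurwitzSum (1 / 2) (k + 1) - 4 * H2 k = 4 * (H2 (1 + 2 * k) - 5 / 4 * H2 k) := by
  induction k with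
  | zero => norm_num [hurwitzSum, H2]
  | succ k ih =>
    rw [hurwitzSum_succ, H2_succ k, show 1 + 2 * (k + 1) = 1 + 2 * k + 1 + 1 by ring, H2_succ,
      H2_succ]
    have : hurwitzSum (1 / 2) (k + 1) = 4 * (H2 (1 + 2 * k) - 5 / 4 * H2 k) + 4 * H2 k := by
      linarith
    rw [this]
    push_cast
    field_simp
    ring

theorem accelTerm_zero_left (k : ℕ) :
    accelTerm 0 k = 4 * (1 / (-8) ^ k * (poch 1 k ^ 3 / poch (3 / 2) k ^ 3)) := by
  have h := mul_poch_add_one (1 / 2) k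
  rw [← poch_succ, show (1 / 2 + 1 : ℝ) = 3 / 2 by norm_num] at h
  have h2 := poch_pos (x := 3 / 2) (by norm_num) k
  rw [accelTerm, poch_one, zero_add, ← h]
  simp only [mul_zero, zero_add, pow_zero]
  field_simp
  ring

theorem stmt0 :
    (∑' k : ℕ, (2 + 3 * (k : ℝ)) / (-8 : ℝ) ^ k * (poch 1 k ^ 3 / poch (3/2) k ^ 3) *
      (H2 (1 + 2 * k) - 5/4 * H2 k)) = 2 * beta4 := by
  have h := tsum_accelCoeff_zero
  rw [tsum_gaussCoeff_half, tsum_congr (g := fun k : ℕ => 16 * ((2 + 3 * (k : ℝ)) / (-8 : ℝ) ^ k *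
    (poch 1 k ^ 3 / poch (3/2) k ^ 3) * (H2 (1 + 2 * k) - 5/4 * H2 k))) fun k => by
      rw [accelCoeff, zero_add, hurwitzSum_half, accelTerm_zero_left]; ring, tsum_mul_left] at h
  linarith
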